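/- arXiv:2404.01152 — 2 statements merged into one kernel-verified Lean document; each statement's English description precedes it below -/
import Mathlib

section
/- Let n ≥ 3, let Ω ⊂ ℝ^n be a bounded open set, and let μ be a bounded measure on closure(Ω). If ∫_{closure(Ω)} |x−y|^{4−2n} dμ(y) = 0 for every x ∈ ℝ^n \ closure(Ω), then all polynomial moments of μ vanish: ∫_{closure(Ω)} y^α dμ(y) = 0 for every multi-index α ∈ ℕ^n, where y^α = y_1^{α_1} ⋯ y_n^{α_n}. -/
open Filter Topology

/-- The squared distance to `x`, as a continuous function on `K`. -/
noncomputable def sqDistMap {n : ℕ} (K : Set (EuclideanSpace ℝ (Fin n))) (x : EuclideanSpace ℝ (Fin n)) :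
    C(K, ℝ) :=
  ⟨fun y => ‖x - (y : EuclideanSpace ℝ (Fin n))‖ ^ 2, by fun_prop⟩

/-- The `i`-th coordinate of `x - y`, as a continuous function of `y ∈ K`. -/
def coordSubMap {n : ℕ} (K : Set (EuclideanSpace ℝ (Fin n))) (x : EuclideanSpace ℝ (Fin n))
    (i : Fin n) : C(K, ℝ) :=
  ⟨fun y => x i - (y : EuclideanSpace ℝ (Fin n)) i, by fun_prop⟩

section

variable {n : ℕ} {K : Set (EuclideanSpace ℝ (Fin n))}

lemma sqDistMap_add_single (x : EuclideanSpace ℝ (Fin n)) (i : Fin n) (t : ℝ) :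
    sqDistMap K (x + t • EuclideanSpace.single i (1 : ℝ)) =
      sqDistMap K x + (2 * t) • coordSubMap K x i + (t ^ 2) • (1 : C(K, ℝ)) := by
  ext y
  have h : x + t • EuclideanSpace.single i (1 : ℝ) - (y : EuclideanSpace ℝ (Fin n)) =
      (x - y) + t • EuclideanSpace.single i (1 : ℝ) := by abel
  simp only [sqDistMap, coordSubMap, ContinuousMap.coe_mk, ContinuousMap.add_apply,
    ContinuousMap.smul_apply, ContinuousMap.one_apply, smul_eq_mul, h]
  rw [norm_add_sq_real, inner_smul_right, EuclideanSpace.inner_single_right, norm_smul,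
    PiLp.norm_single]
  simp
  ring

lemma coordSubMap_add_single (x : EuclideanSpace ℝ (Fin n)) (i : Fin n) (t : ℝ) :
    coordSubMap K (x + t • EuclideanSpace.single i (1 : ℝ)) i =
      coordSubMap K x i + t • (1 : C(K, ℝ)) := by
  ext y
  simp [coordSubMap]
  ring

lemma sum_coordSubMap_sq (x : EuclideanSpace ℝ (Fin n)) :
    ∑ i, coordSubMap K x i ^ 2 = sqDistMap K x := by
  ext y
  simp [coordSubMap, sqDistMap, EuclideanSpace.norm_sq_eq]

lemma sqDistMap_pos {x : EuclideanSpace ℝ (Fin n)} (hx : x ∉ K) (y : K) :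
    0 < sqDistMap K x y := by
  have h : x - (y : EuclideanSpace ℝ (Fin n)) ≠ 0 :=
    sub_ne_zero.mpr fun h => hx (h ▸ y.2)
  have := norm_pos_iff.mpr h
  simp only [sqDistMap, ContinuousMap.coe_mk]
  positivity

lemma isUnit_sqDistMap {x : EuclideanSpace ℝ (Fin n)} (hx : x ∉ K) :
    IsUnit (sqDistMap K x) :=
  ContinuousMap.isUnit_iff_forall_ne_zero _ |>.mpr fun y => (sqDistMap_pos hx y).ne'

lemma inverse_sqDistMap_apply {x : EuclideanSpace ℝ (Fin n)} (hx : x ∉ K) (y : K) :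
    Ring.inverse (sqDistMap K x) y = (sqDistMap K x y)⁻¹ := by
  refine eq_inv_of_mul_eq_one_left ?_
  rw [← ContinuousMap.mul_apply, Ring.inverse_mul_cancel _ (isUnit_sqDistMap hx),
    ContinuousMap.one_apply]

variable [CompactSpace K]

lemma hasDerivAt_inverse_sqDistMap {x : EuclideanSpace ℝ (Fin n)} (hx : x ∉ K) (i : Fin n) :
    HasDerivAt
      (fun t : ℝ => Ring.inverse (sqDistMap K (x + t • EuclideanSpace.single i (1 : ℝ))))
      (-(2 : ℝ) • (Ring.inverse (sqDistMap K x) ^ 2 * coordSubMap K x i)) 0 := by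
  have hq : HasDerivAt (fun t : ℝ => sqDistMap K (x + t • EuclideanSpace.single i (1 : ℝ)))
      ((2 : ℝ) • coordSubMap K x i) 0 := by
    simp only [sqDistMap_add_single]
    have h1 : HasDerivAt (fun t : ℝ => 2 * t) 2 0 := by
      simpa using (hasDerivAt_id (0 : ℝ)).const_mul 2
    have h2 : HasDerivAt (fun t : ℝ => t ^ 2) 0 0 := by
      simpa using hasDerivAt_pow 2 (0 : ℝ)
    refine (((h1.smul_const (coordSubMap K x i)).const_add (sqDistMap K x)).add
      (h2.smul_const (1 : C(K, ℝ)))).congr_deriv ?_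
    simp
  obtain ⟨u, hu⟩ := isUnit_sqDistMap hx
  have hinv := hasFDerivAt_ringInverse (𝕜 := ℝ) u
  have h0 : (u : C(K, ℝ)) = sqDistMap K (x + (0 : ℝ) • EuclideanSpace.single i (1 : ℝ)) := by
    simp [hu]
  rw [h0] at hinv
  refine (hinv.comp_hasDerivAt (0 : ℝ) hq).congr_deriv ?_
  rw [← hu, Ring.inverse_unit]
  ext y
  simp
  ring

lemma hasDerivAt_coordSubMap (x : EuclideanSpace ℝ (Fin n)) (i : Fin n) :
    HasDerivAt (fun t : ℝ => coordSubMap K (x + t • EuclideanSpace.single i (1 : ℝ)) i)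
      (1 : C(K, ℝ)) 0 := by
  simp only [coordSubMap_add_single]
  simpa using ((hasDerivAt_id (0 : ℝ)).smul_const (1 : C(K, ℝ))).const_add (coordSubMap K x i)

variable {F : Type*} [NormedAddCommGroup F] [NormedSpace ℝ F] (ν : C(K, ℝ) →L[ℝ] F)

/-- If `ν` annihilates a family of functions indexed by the points off `K`, it annihilates its
partial derivatives. -/
lemma map_eq_zero_of_hasDerivAt {G : EuclideanSpace ℝ (Fin n) → C(K, ℝ)}
    (hG : ∀ x ∉ K, ν (G x) = 0) {x : EuclideanSpace ℝ (Fin n)} (hx : x ∉ K) {i : Fin n}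
    {g : C(K, ℝ)}
    (hg : HasDerivAt (fun t : ℝ => G (x + t • EuclideanSpace.single i (1 : ℝ))) g 0) :
    ν g = 0 := by
  have hK : IsClosed K := (isCompact_iff_compactSpace.mpr inferInstance).isClosed
  have hcont : Continuous fun t : ℝ => x + t • EuclideanSpace.single i (1 : ℝ) := by fun_prop
  have hev : ∀ᶠ t : ℝ in 𝓝 0, x + t • EuclideanSpace.single i (1 : ℝ) ∈ Kᶜ :=
    hcont.continuousAt.eventually_mem (hK.isOpen_compl.mem_nhds (by simpa using hx))
  have h1 := ν.hasFDerivAt.comp_hasDerivAt (0 : ℝ) hg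
  have h2 : HasDerivAt (ν ∘ fun t : ℝ => G (x + t • EuclideanSpace.single i (1 : ℝ)))
      (0 : F) 0 :=
    (hasDerivAt_const (0 : ℝ) (0 : F)).congr_of_eventuallyEq
      (hev.mono fun t ht => hG _ ht)
  exact h1.unique h2

/-- Applying the Laplacian to `|x - y|^{-2k}` raises the exponent, as long as `2k + 2 > n`. -/
lemma map_inverse_sqDistMap_pow_succ {k : ℕ} (hk : 0 < k) (hkn : n < 2 * k + 2)
    (h : ∀ x ∉ K, ν (Ring.inverse (sqDistMap K x) ^ k) = 0) :
    ∀ x ∉ K, ν (Ring.inverse (sqDistMap K x) ^ (k + 1)) = 0 := by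
  have hgrad : ∀ i, ∀ x ∉ K,
      ν (Ring.inverse (sqDistMap K x) ^ (k + 1) * coordSubMap K x i) = 0 := by
    intro i x hx
    have h1 := map_eq_zero_of_hasDerivAt ν h hx ((hasDerivAt_inverse_sqDistMap hx i).pow k)
    have h2 : (k : C(K, ℝ)) * Ring.inverse (sqDistMap K (x + (0 : ℝ) •
        EuclideanSpace.single i (1 : ℝ))) ^ (k - 1) *
        (-(2 : ℝ) • (Ring.inverse (sqDistMap K x) ^ 2 * coordSubMap K x i)) =
        (-(2 * k : ℝ)) • (Ring.inverse (sqDistMap K x) ^ (k + 1) * coordSubMap K x i) := by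
      obtain ⟨m, rfl⟩ : ∃ m, k = m + 1 := ⟨k - 1, by omega⟩
      ext y
      simp
      ring
    rw [h2, map_smul] at h1
    exact (smul_eq_zero.mp h1).resolve_left (by simp [hk.ne'])
  intro x hx
  set p := Ring.inverse (sqDistMap K x) with hp
  have hsecond : ∀ i, ν ((-(2 * (k + 1) : ℝ)) • (p ^ (k + 2) * coordSubMap K x i ^ 2) +
      p ^ (k + 1)) = 0 := by
    intro i
    have h1 := map_eq_zero_of_hasDerivAt ν (hgrad i) hx
      (((hasDerivAt_inverse_sqDistMap hx i).pow (k + 1)).mul (hasDerivAt_coordSubMap x i))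
    rw [← h1]
    congr 1
    ext y
    simp [← hp]
    ring
  have hsum : ∑ i : Fin n, ((-(2 * (k + 1) : ℝ)) • (p ^ (k + 2) * coordSubMap K x i ^ 2) +
      p ^ (k + 1)) = ((n : ℝ) - 2 * (k + 1)) • p ^ (k + 1) := by
    rw [Finset.sum_add_distrib, ← Finset.smul_sum, ← Finset.mul_sum, sum_coordSubMap_sq,
      pow_succ p (k + 1), mul_assoc, Ring.inverse_mul_cancel _ (isUnit_sqDistMap hx)]
    ext y
    simp
    ring
  have h3 : ((n : ℝ) - 2 * (k + 1)) • ν (p ^ (k + 1)) = 0 := by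
    rw [← map_smul, ← hsum, map_sum]
    exact Finset.sum_eq_zero fun i _ => hsecond i
  refine (smul_eq_zero.mp h3).resolve_left ?_
  have : (n : ℝ) < 2 * k + 2 := by exact_mod_cast hkn
  linarith

/-- By the Weierstrass approximation theorem, a functional annihilating all large powers of
`|x - y|^{-2}` annihilates every continuous function of `|x - y|^2`. -/
lemma map_comp_sqDistMap_eq_zero {s : ℕ} {x : EuclideanSpace ℝ (Fin n)} (hx : x ∉ K)
    (h : ∀ k, s ≤ k → ν (Ring.inverse (sqDistMap K x) ^ k) = 0) (φ : C(ℝ, ℝ)) :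
    ν (φ.comp (sqDistMap K x)) = 0 := by
  set p := Ring.inverse (sqDistMap K x) with hp
  have hppos : ∀ y, 0 < p y := fun y => by
    rw [hp, inverse_sqDistMap_apply hx]
    exact inv_pos.mpr (sqDistMap_pos hx y)
  obtain ⟨a, b, ha, hab⟩ : ∃ a b : ℝ, 0 < a ∧ ∀ y, p y ∈ Set.Icc a b := by
    obtain ⟨b, hb⟩ := (isCompact_range p.continuous).bddAbove
    obtain ⟨c, hc⟩ := (isCompact_range (sqDistMap K x).continuous).bddAbove
    refine ⟨(max c 1)⁻¹, b, by positivity, fun y => ⟨?_, hb ⟨y, rfl⟩⟩⟩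
    rw [hp, inverse_sqDistMap_apply hx]
    exact inv_anti₀ (sqDistMap_pos hx y) ((hc ⟨y, rfl⟩).trans (le_max_left _ _))
  have hpoly : ∀ q : Polynomial ℝ, ν (p ^ s * Polynomial.aeval p q) = 0 := by
    intro q
    rw [Polynomial.aeval_eq_sum_range, Finset.mul_sum, map_sum]
    refine Finset.sum_eq_zero fun j _ => ?_
    rw [mul_smul_comm, ← pow_add, map_smul, h _ (Nat.le_add_right _ _), smul_zero]
  set g : ℝ → ℝ := fun u => φ u⁻¹ * (u ^ s)⁻¹ with hg
  have hgc : ContinuousOn g (Set.Icc a b) := by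
    have hne : ∀ u ∈ Set.Icc a b, u ≠ 0 := fun u hu => (ha.trans_le hu.1).ne'
    refine (φ.continuous.comp_continuousOn (continuousOn_id.inv₀ hne)).mul ?_
    exact (continuousOn_id.pow s).inv₀ fun u hu => pow_ne_zero _ (hne u hu)
  have hclosed : IsClosed {f : C(K, ℝ) | ν f = 0} := isClosed_eq ν.continuous continuous_const
  change φ.comp (sqDistMap K x) ∈ {f : C(K, ℝ) | ν f = 0}
  rw [← hclosed.closure_eq, Metric.mem_closure_iff]
  intro ε hε
  obtain ⟨q, hq⟩ := exists_polynomial_near_of_continuousOn a b g hgc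
    (ε / (‖p ^ s‖ + 1)) (by positivity)
  refine ⟨p ^ s * Polynomial.aeval p q, hpoly q, ?_⟩
  rw [ContinuousMap.dist_lt_iff hε]
  intro y
  have hy : Polynomial.aeval p q y = q.eval (p y) := by
    simp [Polynomial.aeval_eq_sum_range, Polynomial.eval_eq_sum_range,
      ContinuousMap.sum_apply]
  have hφ : φ.comp (sqDistMap K x) y = p y ^ s * g (p y) := by
    have := (hppos y).ne'
    have h1 : (p y)⁻¹ = sqDistMap K x y := by rw [hp, inverse_sqDistMap_apply hx, inv_inv]
    simp only [hg, ContinuousMap.comp_apply, h1]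
    field_simp
  rw [hφ, ContinuousMap.mul_apply, hy, ContinuousMap.pow_apply, Real.dist_eq, ← mul_sub,
    abs_mul, abs_sub_comm]
  have hle : |p y ^ s| ≤ ‖p ^ s‖ := (p ^ s).norm_coe_le_norm y
  calc |p y ^ s| * |q.eval (p y) - g (p y)|
      ≤ ‖p ^ s‖ * (ε / (‖p ^ s‖ + 1)) := by gcongr; exact (hq _ (hab y)).le
    _ < (‖p ^ s‖ + 1) * (ε / (‖p ^ s‖ + 1)) := by gcongr; linarith
    _ = ε := by field_simp

/-- The exponential of the linear form `⟪w, ·⟫`, restricted to `K`. -/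
noncomputable def expInnerMap (K : Set (EuclideanSpace ℝ (Fin n)))
    (w : EuclideanSpace ℝ (Fin n)) : C(K, ℝ) :=
  ⟨fun y => Real.exp (inner ℝ w (y : EuclideanSpace ℝ (Fin n))), by fun_prop⟩

/-- The centres `R w` with `R → ∞` turn functions of `|x - y|^2` into functions of `⟪w, y⟫`. -/
lemma map_expInnerMap_eq_zero (hn : 0 < n)
    (h : ∀ x ∉ K, ∀ φ : C(ℝ, ℝ), ν (φ.comp (sqDistMap K x)) = 0)
    (w : EuclideanSpace ℝ (Fin n)) : ν (expInnerMap K w) = 0 := by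
  have : Nonempty (Fin n) := ⟨⟨0, hn⟩⟩
  have hK : Bornology.IsBounded K :=
    (isCompact_iff_compactSpace.mpr inferInstance : IsCompact K).isBounded
  rcases eq_or_ne w 0 with rfl | hw
  · obtain ⟨x, hx⟩ : ∃ x, x ∉ K := by
      by_contra! hall
      exact NormedSpace.unbounded_univ ℝ (EuclideanSpace ℝ (Fin n))
        (Set.eq_univ_of_forall hall ▸ hK)
    rw [← h x hx (ContinuousMap.const ℝ 1)]
    congr 1
    ext y
    simp [expInnerMap]
  let G : ℝ → C(K, ℝ) := fun c =>
    (⟨Real.exp, Real.continuous_exp⟩ : C(ℝ, ℝ)).comp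
      ((⟨fun y => inner ℝ w (y : EuclideanSpace ℝ (Fin n)), by fun_prop⟩ : C(K, ℝ)) -
        c • sqDistMap K 0)
  have hG : Continuous G := (ContinuousMap.continuous_postcomp _).comp (by fun_prop)
  have hG0 : G 0 = expInnerMap K w := by
    ext y
    simp [G, expInnerMap]
  have htend : Tendsto (fun R : ℝ => ν (G (2 * R)⁻¹)) atTop (𝓝 (ν (G 0))) := by
    refine ((ν.continuous.comp hG).tendsto 0).comp ?_
    exact tendsto_inv_atTop_zero.comp (tendsto_id.const_mul_atTop two_pos)
  obtain ⟨C, hC⟩ := hK.exists_norm_le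
  have hwpos : 0 < ‖w‖ := norm_pos_iff.mpr hw
  have hzero : ∀ᶠ R : ℝ in atTop, ν (G (2 * R)⁻¹) = 0 := by
    filter_upwards [eventually_gt_atTop 0, eventually_gt_atTop (C / ‖w‖)] with R hR hRC
    have hx : R • w ∉ K := fun hmem => by
      have h1 := hC _ hmem
      rw [norm_smul, Real.norm_of_nonneg hR.le] at h1
      rw [div_lt_iff₀ hwpos] at hRC
      linarith
    rw [← h _ hx ⟨fun t => Real.exp ((‖R • w‖ ^ 2 - t) / (2 * R)), by fun_prop⟩]
    congr 1
    ext y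
    simp only [G, sqDistMap, ContinuousMap.comp_apply, ContinuousMap.coe_mk,
      ContinuousMap.sub_apply, ContinuousMap.smul_apply, smul_eq_mul]
    rw [norm_sub_sq_real (R • w), inner_smul_left, zero_sub, norm_neg]
    congr 1
    simp
    field_simp
    ring
  rw [← hG0]
  exact tendsto_nhds_unique htend (tendsto_const_nhds.congr' (hzero.mono fun R hR => hR.symm))

/-- The exponentials `exp ⟪w, ·⟫` span a dense subspace of `C(K, ℝ)`. -/
lemma eq_zero_of_map_expInnerMap_eq_zero (h : ∀ w, ν (expInnerMap K w) = 0)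
    (f : C(K, ℝ)) : ν f = 0 := by
  let M : Submonoid C(K, ℝ) :=
    { carrier := Set.range (expInnerMap K)
      one_mem' := ⟨0, by ext y; simp [expInnerMap]⟩
      mul_mem' := by
        rintro _ _ ⟨v, rfl⟩ ⟨w, rfl⟩
        exact ⟨v + w, by ext y; simp [expInnerMap, inner_add_left, Real.exp_add]⟩ }
  have hspan : ∀ g ∈ Algebra.adjoin ℝ (M : Set C(K, ℝ)), ν g = 0 := by
    intro g hg
    rw [← Subalgebra.mem_toSubmodule, Algebra.adjoin_eq_span, Submonoid.closure_eq] at hg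
    refine Submodule.span_induction ?_ (map_zero ν) ?_ ?_ hg
    · rintro _ ⟨w, rfl⟩
      exact h w
    · intro a b _ _ ha hb
      rw [map_add, ha, hb, add_zero]
    · intro c a _ ha
      rw [map_smul, ha, smul_zero]
  have hsep : (Algebra.adjoin ℝ (M : Set C(K, ℝ))).SeparatesPoints := by
    intro y z hyz
    refine ⟨_, ⟨expInnerMap K ((y : EuclideanSpace ℝ (Fin n)) - z),
      Algebra.subset_adjoin ⟨_, rfl⟩, rfl⟩, fun heq => hyz ?_⟩
    have h1 := Real.exp_injective heq
    have h2 : inner ℝ ((y : EuclideanSpace ℝ (Fin n)) - z)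
        ((y : EuclideanSpace ℝ (Fin n)) - z) = 0 := by
      rw [inner_sub_right, h1, sub_self]
    exact Subtype.ext (sub_eq_zero.mp (inner_self_eq_zero.mp h2))
  have hdense := ContinuousMap.subalgebra_topologicalClosure_eq_top_of_separatesPoints _ hsep
  have hmem : f ∈ (Algebra.adjoin ℝ (M : Set C(K, ℝ))).topologicalClosure :=
    hdense ▸ Algebra.mem_top
  exact closure_minimal (t := {f : C(K, ℝ) | ν f = 0}) hspan
    (isClosed_eq ν.continuous continuous_const) hmem

end

/-- Let `n ≥ 3`, `Ω ⊂ ℝ^n` a bounded open set, and let `μ` be a bounded measure on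
`closure Ω` (an element of the dual of `C(closure Ω, ℂ)`). If
`∫ |x - y|^{4-2n} dμ(y) = 0` for every `x ∈ ℝ^n \ closure Ω`, then all polynomial moments
of `μ` vanish: `∫ y^α dμ(y) = 0` for every multi-index `α ∈ ℕ^n`. -/
theorem moments_vanish_of_green_products_integrals_vanish
    (n : ℕ) (hn : 3 ≤ n) (Ω : Set (EuclideanSpace ℝ (Fin n)))
    (hΩo : IsOpen Ω) (hΩb : Bornology.IsBounded Ω)
    (μ : C(closure Ω, ℂ) →L[ℂ] ℂ)
    (hμ : ∀ x : EuclideanSpace ℝ (Fin n), x ∉ closure Ω →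
      ∀ f : C(closure Ω, ℂ),
        (∀ y : closure Ω,
          f y = ((‖x - (y : EuclideanSpace ℝ (Fin n))‖ ^ ((4 : ℝ) - 2 * n) : ℝ) : ℂ)) →
        μ f = 0) :
    ∀ α : Fin n → ℕ, ∀ f : C(closure Ω, ℂ),
      (∀ y : closure Ω,
        f y = ∏ j, (((y : EuclideanSpace ℝ (Fin n)) j : ℂ) ^ α j)) →
      μ f = 0 := by
  have : CompactSpace (closure Ω) := isCompact_iff_compactSpace.mp hΩb.isCompact_closure
  let ν : C(closure Ω, ℝ) →L[ℝ] ℂ :=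
    (μ.restrictScalars ℝ).comp (Complex.ofRealCLM.compLeftContinuous ℝ (closure Ω))
  have hbase : ∀ x ∉ closure Ω,
      ν (Ring.inverse (sqDistMap (closure Ω) x) ^ (n - 2)) = 0 := by
    intro x hx
    refine hμ x hx _ fun y => ?_
    have h1 : ((4 : ℝ) - 2 * n) = -((2 * (n - 2) : ℕ) : ℝ) := by
      push_cast [Nat.cast_sub (show 2 ≤ n by omega)]
      ring
    rw [h1, Real.rpow_neg (norm_nonneg _), Real.rpow_natCast, pow_mul, ← inv_pow]
    change ((((Ring.inverse (sqDistMap (closure Ω) x)) ^ (n - 2)) y : ℝ) : ℂ) = _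
    rw [ContinuousMap.pow_apply, inverse_sqDistMap_apply hx]
    rfl
  have hpow : ∀ k, n - 2 ≤ k → ∀ x ∉ closure Ω,
      ν (Ring.inverse (sqDistMap (closure Ω) x) ^ k) = 0 := by
    intro k hk
    induction k, hk using Nat.le_induction with
    | base => exact hbase
    | succ k hk ih => exact map_inverse_sqDistMap_pow_succ ν (by omega) (by omega) ih
  have hν : ∀ g, ν g = 0 :=
    eq_zero_of_map_expInnerMap_eq_zero ν <| map_expInnerMap_eq_zero ν (by omega)
      fun x hx φ => map_comp_sqDistMap_eq_zero ν hx (fun k hk => hpow k hk x hx) φ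
  intro α f hf
  rw [← hν ⟨fun y => ∏ j, (y : EuclideanSpace ℝ (Fin n)) j ^ α j, by fun_prop⟩]
  change μ f = μ _
  congr 1
  ext y
  rw [hf]
  simp
end

section
/- Let n ≥ 2 and let Ω ⊂ ℝ^n be a bounded open set. Then the ℂ-linear span of the set of products { u₁ u₂ : u₁, u₂ are harmonic homogeneous polynomials on ℝ^n } is dense in C(closure(Ω), ℂ) with respect to the supremum norm. -/
open MvPolynomial

/-- A harmonic homogeneous polynomial on `ℝ^n` (with complex coefficients): a polynomial in
`n` variables that is homogeneous of some degree `d ≥ 0` and whose (algebraic) Laplacian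
`Σ_j ∂²/∂x_j²` vanishes. -/
def IsHarmonicHomogeneousPolynomial {n : ℕ} (p : MvPolynomial (Fin n) ℂ) : Prop :=
  (∃ d : ℕ, p.IsHomogeneous d) ∧
    ∑ j : Fin n, MvPolynomial.pderiv j (MvPolynomial.pderiv j p) = 0

/-- Powers of a complex linear form with isotropic coefficient vector are harmonic homogeneous
polynomials. -/
lemma isHarmonicHomogeneousPolynomial_pow {n : ℕ} (ζ : Fin n → ℂ) (hζ : ∑ j, ζ j ^ 2 = 0)
    (k : ℕ) : IsHarmonicHomogeneousPolynomial ((∑ j, C (ζ j) * X j) ^ k) := by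
  refine ⟨⟨1 * k, IsHomogeneous.pow (IsHomogeneous.sum _ _ _ fun j _ => ?_) k⟩, ?_⟩
  · simpa using (isHomogeneous_C (Fin n) (ζ j)).mul (isHomogeneous_X ℂ j)
  · set p : MvPolynomial (Fin n) ℂ := ∑ j, C (ζ j) * X j with hp
    have hd (j : Fin n) : pderiv j p = C (ζ j) := by
      simp [hp, pderiv_X, Pi.single_apply]
    have h2 (j : Fin n) : pderiv j (pderiv j (p ^ k)) =
        (k : MvPolynomial (Fin n) ℂ) * ((k - 1 : ℕ) : MvPolynomial (Fin n) ℂ) * p ^ (k - 1 - 1) * C (ζ j ^ 2) := by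
      simp only [pderiv_pow, hd, Derivation.leibniz, pderiv_C, Derivation.map_natCast,
        smul_eq_mul, C_pow]
      ring
    simp_rw [h2]
    rw [← Finset.mul_sum, ← map_sum, hζ, C_0, mul_zero]

/-- In dimension at least two every vector has an orthogonal vector of the same norm. -/
lemma exists_norm_eq_inner_eq_zero {E : Type*} [NormedAddCommGroup E] [InnerProductSpace ℝ E]
    [FiniteDimensional ℝ E] (hE : 2 ≤ Module.finrank ℝ E) (ξ : E) :
    ∃ η : E, ‖η‖ = ‖ξ‖ ∧ inner ℝ ξ η = 0 := by
  have hker : LinearMap.ker (innerₛₗ ℝ ξ) ≠ ⊥ :=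
    LinearMap.ker_ne_bot_of_finrank_lt (by rw [Module.finrank_self]; lia)
  obtain ⟨v, hv, hv0⟩ := Submodule.exists_mem_ne_zero_of_ne_bot hker
  have hv' : inner ℝ ξ v = 0 := by simpa using hv
  refine ⟨(‖ξ‖ / ‖v‖) • v, ?_, by rw [inner_smul_right, hv', mul_zero]⟩
  rw [norm_smul, norm_div, norm_norm, norm_norm, div_mul_cancel₀ _ (norm_ne_zero_iff.2 hv0)]

/-- In dimension at least two every real vector is the sum of two isotropic complex vectors. -/
lemma exists_isotropic_add_eq {n : ℕ} (hn : 2 ≤ n) (ξ : EuclideanSpace ℝ (Fin n)) :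
    ∃ ζ ζ' : Fin n → ℂ, ∑ j, ζ j ^ 2 = 0 ∧ ∑ j, ζ' j ^ 2 = 0 ∧ ∀ j, ζ j + ζ' j = ξ j := by
  obtain ⟨η, hη, hin⟩ := exists_norm_eq_inner_eq_zero (by simpa using hn) ξ
  have hsq : ∑ j, (η j : ℂ) ^ 2 = ∑ j, (ξ j : ℂ) ^ 2 := by
    have h := congrArg (fun t : ℝ => t ^ 2) hη
    simp only [EuclideanSpace.real_norm_sq_eq] at h
    exact_mod_cast h
  have hin' : ∑ j, (ξ j : ℂ) * η j = 0 := by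
    simp only [PiLp.inner_apply, RCLike.inner_apply, conj_trivial] at hin
    simp_rw [mul_comm (ξ _ : ℂ)]
    exact_mod_cast hin
  have key (s : ℂ) (hs : s ^ 2 = -1) : ∑ j, ((ξ j + s * η j) / 2 : ℂ) ^ 2 = 0 := by
    calc ∑ j, ((ξ j + s * η j) / 2 : ℂ) ^ 2
        = (∑ j, (ξ j : ℂ) ^ 2 + 2 * s * ∑ j, (ξ j : ℂ) * η j
            + s ^ 2 * ∑ j, (η j : ℂ) ^ 2) / 4 := by
          rw [Finset.mul_sum, Finset.mul_sum, ← Finset.sum_add_distrib,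
            ← Finset.sum_add_distrib, Finset.sum_div]
          exact Finset.sum_congr rfl fun j _ => by ring
      _ = 0 := by rw [hin', hsq, hs]; ring
  exact ⟨_, _, key Complex.I (by simp), key (-Complex.I) (by simp), fun j => by ring⟩

/-- The function `x ↦ ⟪ξ, x⟫`, as a complex-valued continuous function on a set. -/
noncomputable def innerContinuousMap {n : ℕ} (K : Set (EuclideanSpace ℝ (Fin n)))
    (ξ : EuclideanSpace ℝ (Fin n)) : C(K, ℂ) where
  toFun x := (inner ℝ ξ (x : EuclideanSpace ℝ (Fin n)) : ℝ)

/-- A closed subspace of `C(K, ℂ)` containing all powers of real linear forms is everything. -/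
lemma eq_top_of_innerContinuousMap_pow_mem {n : ℕ} (K : Set (EuclideanSpace ℝ (Fin n)))
    [CompactSpace K] (S : Submodule ℂ C(K, ℂ)) (hS : IsClosed (S : Set C(K, ℂ)))
    (h : ∀ ξ m, innerContinuousMap K ξ ^ m ∈ S) : S = ⊤ := by
  let E : EuclideanSpace ℝ (Fin n) → C(K, ℂ) := fun ξ => NormedSpace.exp (innerContinuousMap K ξ)
  have hE (ξ) : E ξ ∈ S := by
    refine hS.mem_of_tendsto (NormedSpace.exp_series_hasSum_exp' (𝕂 := ℂ) (innerContinuousMap K ξ))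
      (Filter.Eventually.of_forall fun s => ?_)
    exact S.sum_mem fun m _ => S.smul_mem _ (h ξ m)
  have hE_apply (ξ) (x : K) : E ξ x = (Real.exp (inner ℝ ξ (x : EuclideanSpace ℝ (Fin n))) : ℝ) := by
    rw [Complex.ofReal_exp, Complex.exp_eq_exp_ℂ]
    exact NormedSpace.map_exp
      (ContinuousMap.evalAlgHom ℂ ℂ x) (continuous_eval_const x) _
  let M : Submonoid C(K, ℂ) :=
    { carrier := Set.range E
      one_mem' := ⟨0, by ext x; simp [hE_apply]⟩
      mul_mem' := by
        rintro _ _ ⟨ξ, rfl⟩ ⟨η, rfl⟩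
        exact ⟨ξ + η, by ext x; simp [hE_apply, inner_add_left, Complex.exp_add]⟩ }
  have hstar : star (Set.range E) = Set.range E := by
    have h1 (ξ) : star (E ξ) = E ξ := by
      ext x
      rw [ContinuousMap.star_apply, hE_apply]
      exact Complex.conj_ofReal _
    ext f
    rw [Set.mem_star]
    constructor
    · rintro ⟨ξ, hξ⟩
      exact ⟨ξ, by rw [← h1, hξ, star_star]⟩
    · rintro ⟨ξ, rfl⟩
      exact ⟨ξ, (h1 ξ).symm⟩
  have hadj : (StarAlgebra.adjoin ℂ (Set.range E)).toSubalgebra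
      = Algebra.adjoin ℂ (Set.range E) := by
    rw [StarAlgebra.adjoin_toSubalgebra, hstar, Set.union_self]
  have hle : Subalgebra.toSubmodule (Algebra.adjoin ℂ (Set.range E)) ≤ S := by
    rw [Algebra.adjoin_eq_span, show Set.range E = (M : Set C(K, ℂ)) from rfl,
      Submonoid.closure_eq, Submodule.span_le]
    rintro _ ⟨ξ, rfl⟩
    exact hE ξ
  have hsep : (StarAlgebra.adjoin ℂ (Set.range E)).SeparatesPoints := by
    intro x y hxy
    by_contra! hcon
    refine hxy (Subtype.ext (ext_inner_left ℝ fun ξ => ?_))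
    have : E ξ x = E ξ y := hcon _ ⟨E ξ, StarAlgebra.subset_adjoin ℂ _ ⟨ξ, rfl⟩, rfl⟩
    rw [hE_apply, hE_apply] at this
    exact Real.exp_injective (Complex.ofReal_injective this)
  have htop := ContinuousMap.starSubalgebra_topologicalClosure_eq_top_of_separatesPoints _ hsep
  rw [eq_top_iff]
  intro f _
  have hf : f ∈ (StarAlgebra.adjoin ℂ (Set.range E)).topologicalClosure := htop ▸ trivial
  refine closure_minimal (fun g hg => hle ?_) hS hf
  rw [← hadj]
  exact hg

/-- **Completeness of products of harmonic homogeneous polynomials.** Let `n ≥ 2` and let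
`Ω ⊂ ℝ^n` be a bounded open set. The ℂ-linear span of the set of products `u₁ u₂` of
harmonic homogeneous polynomials on `ℝ^n` is dense in `C(closure Ω, ℂ)` (with the supremum
norm, i.e. the compact-open topology on the compact set `closure Ω`). -/
theorem density_of_products_of_harmonic_homogeneous_polynomials
    (n : ℕ) (hn : 2 ≤ n) (Ω : Set (EuclideanSpace ℝ (Fin n)))
    (hΩo : IsOpen Ω) (hΩb : Bornology.IsBounded Ω) :
    Dense (↑(Submodule.span ℂ
      {f : C(closure Ω, ℂ) | ∃ p₁ p₂ : MvPolynomial (Fin n) ℂ,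
        IsHarmonicHomogeneousPolynomial p₁ ∧ IsHarmonicHomogeneousPolynomial p₂ ∧
        ∀ x : closure Ω,
          f x = MvPolynomial.eval (fun j => (((x : EuclideanSpace ℝ (Fin n)) j : ℂ))) p₁ *
            MvPolynomial.eval (fun j => (((x : EuclideanSpace ℝ (Fin n)) j : ℂ))) p₂}) :
      Set C(closure Ω, ℂ)) := by
  have : CompactSpace (closure Ω) := isCompact_iff_compactSpace.1 hΩb.isCompact_closure
  rw [Submodule.dense_iff_topologicalClosure_eq_top]
  refine eq_top_of_innerContinuousMap_pow_mem _ _ (Submodule.isClosed_topologicalClosure _)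
    fun ξ m => Submodule.le_topologicalClosure _ ?_
  obtain ⟨ζ, ζ', hζ, hζ', hadd⟩ := exists_isotropic_add_eq hn ξ
  let l (ω : Fin n → ℂ) : C(closure Ω, ℂ) :=
    ⟨fun x => ∑ j, ω j * ((x : EuclideanSpace ℝ (Fin n)) j : ℂ), by fun_prop⟩
  have hsum : innerContinuousMap (closure Ω) ξ = l ζ + l ζ' := by
    ext x
    simp [l, innerContinuousMap, PiLp.inner_apply, ← Finset.sum_add_distrib, ← add_mul, hadd,
      mul_comm]
  rw [hsum, add_pow]
  refine Submodule.sum_mem _ fun k _ => ?_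
  rw [mul_comm, ← nsmul_eq_mul]
  refine Submodule.smul_of_tower_mem _ _ (Submodule.subset_span
    ⟨_, _, isHarmonicHomogeneousPolynomial_pow ζ hζ k,
      isHarmonicHomogeneousPolynomial_pow ζ' hζ' (m - k), fun x => ?_⟩)
  simp [l]
end
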